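/- arXiv:2109.12828 — 6 statements merged into one kernel-verified Lean document; each statement's English description precedes it below -/
import Mathlib

section
/- Let A be a complete NBW with n states, let w be an ω-word, let G be the run DAG of A over w, and let G^0, G^1, …, G^{2n+1} be the pruning sequence of G. Then w ∉ L(A) if and only if every initial ω-branch of G eventually gets trapped in odd ranks, i.e., for every initial ω-branch γ of G there exists m ∈ ℕ such that for every l ≥ m the vertex γ(l) is an F-free vertex of G^i for some odd i with 1 ≤ i ≤ 2n−1. -/
open scoped Classical

/-- A nondeterministic Büchi automaton on ω-words with states `Q` over alphabet `σ`. -/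
structure NBW (σ : Type) (Q : Type) where
  init : Set Q
  trans : Q → σ → Set Q
  acc : Set Q

namespace NBW

variable {σ Q : Type}

/-- `ρ` is a run of `A` on the ω-word `w`. -/
def IsRun (A : NBW σ Q) (w : ℕ → σ) (ρ : ℕ → Q) : Prop :=
  ρ 0 ∈ A.init ∧ ∀ i, ρ (i + 1) ∈ A.trans (ρ i) (w i)

/-- `ρ` is an accepting run of `A` on `w`: it visits `A.acc` infinitely often. -/
def IsAccRun (A : NBW σ Q) (w : ℕ → σ) (ρ : ℕ → Q) : Prop :=
  A.IsRun w ρ ∧ ∀ n, ∃ m, n ≤ m ∧ ρ m ∈ A.acc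

/-- The ω-language accepted by `A`. -/
def Lang (A : NBW σ Q) : Set (ℕ → σ) := {w | ∃ ρ, A.IsAccRun w ρ}

/-- `A` is complete: every state has a successor on every letter. -/
def Complete (A : NBW σ Q) : Prop := ∀ q a, (A.trans q a).Nonempty

/-- `A` is finitely ambiguous: every accepted word has finitely many accepting runs. -/
def FinitelyAmbiguous (A : NBW σ Q) : Prop :=
  ∀ w ∈ A.Lang, {ρ | A.IsAccRun w ρ}.Finite

/-- `A` is limit deterministic with partition `(QN, QD)`. -/
def LimitDetPart (A : NBW σ Q) (QN QD : Set Q) : Prop :=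
  Disjoint QN QD ∧ QN ∪ QD = Set.univ ∧ A.acc ⊆ QD ∧
    ∀ q ∈ QD, ∀ a, ∃ q' ∈ QD, A.trans q a = {q'}

/-- `A` is limit deterministic (for some partition). -/
def LimitDet (A : NBW σ Q) : Prop := ∃ QN QD, A.LimitDetPart QN QD

end NBW

namespace NBW

variable {σ Q : Type}

/-- The set of successors of the set `S` under letter `b`. -/
def dSet (A : NBW σ Q) (S : Set Q) (b : σ) : Set Q := ⋃ q ∈ S, A.trans q b

/-- The set of states occurring at level `ℓ` of the run DAG of `A` over `w`. -/
def levelSet (A : NBW σ Q) (w : ℕ → σ) : ℕ → Set Q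
  | 0 => A.init
  | ℓ + 1 => A.dSet (levelSet A w ℓ) (w ℓ)

/-- Edge of the run DAG `G` of `A` over `w` from vertex `(q, ℓ)` to vertex `(q', ℓ+1)`. -/
def GEdge (A : NBW σ Q) (w : ℕ → σ) (q : Q) (ℓ : ℕ) (q' : Q) : Prop :=
  q ∈ A.levelSet w ℓ ∧ q' ∈ A.trans q (w ℓ)

/-- Edge of the reduced run DAG `Ḡ` of `A` over `w` (wrt the fixed enumeration given
by the linear order on `Q`) from vertex `(q, ℓ)` to vertex `(q', ℓ+1)`:
`q` is the minimal state of level `ℓ` having `q'` as a successor. -/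
def RedEdge (A : NBW σ Q) [LinearOrder Q] (w : ℕ → σ) (q : Q) (ℓ : ℕ) (q' : Q) : Prop :=
  q ∈ A.levelSet w ℓ ∧ q' ∈ A.trans q (w ℓ) ∧
    ∀ p ∈ A.levelSet w ℓ, q' ∈ A.trans p (w ℓ) → q ≤ p

/-- `γ` is an initial ω-branch of the level-indexed DAG with edge relation `E`:
`γ ℓ` is the state of the branch vertex at level `ℓ`. -/
def IsInitOmegaBranch (A : NBW σ Q) (E : Q → ℕ → Q → Prop) (γ : ℕ → Q) : Prop :=
  γ 0 ∈ A.init ∧ ∀ ℓ, E (γ ℓ) ℓ (γ (ℓ + 1))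

/-- The branch `γ` is accepting: it visits `F`-vertices infinitely often. -/
def IsAcceptingBranch (A : NBW σ Q) (γ : ℕ → Q) : Prop :=
  ∀ n, ∃ m, n ≤ m ∧ γ m ∈ A.acc

/-- There is an infinite branch from vertex `(q, ℓ)` inside the sub-DAG with vertex
predicate `P` and edge relation `E`. -/
def SubInfBranch (P : Q → ℕ → Prop) (E : Q → ℕ → Q → Prop) (q : Q) (ℓ : ℕ) : Prop :=
  ∃ γ : ℕ → Q, γ 0 = q ∧ (∀ i, P (γ i) (ℓ + i)) ∧ ∀ i, E (γ i) (ℓ + i) (γ (i + 1))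

/-- Vertex `(q', ℓ')` is reachable from vertex `(q, ℓ)` inside the sub-DAG with
vertex predicate `P` and edge relation `E`. -/
def SubReach (P : Q → ℕ → Prop) (E : Q → ℕ → Q → Prop)
    (q : Q) (ℓ : ℕ) (q' : Q) (ℓ' : ℕ) : Prop :=
  ∃ n, ∃ γ : ℕ → Q, γ 0 = q ∧ γ n = q' ∧ ℓ' = ℓ + n ∧
    (∀ i ≤ n, P (γ i) (ℓ + i)) ∧ ∀ i < n, E (γ i) (ℓ + i) (γ (i + 1))

/-- Vertex `(q, ℓ)` is `F`-free in the sub-DAG with vertex predicate `P` and edge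
relation `E`: it is not finite and no `F`-vertex is reachable from it. -/
def FFreeVtx (A : NBW σ Q) (P : Q → ℕ → Prop) (E : Q → ℕ → Q → Prop)
    (q : Q) (ℓ : ℕ) : Prop :=
  SubInfBranch P E q ℓ ∧ ∀ q' ℓ', SubReach P E q ℓ q' ℓ' → q' ∉ A.acc

/-- The pruning sequence of the DAG with vertex predicate `P0` and edge relation `E`:
odd steps remove the finite vertices, even steps remove the `F`-free vertices,
everything being evaluated in the current graph. -/
def pruneSeq (A : NBW σ Q) (E : Q → ℕ → Q → Prop) (P0 : Q → ℕ → Prop) :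
    ℕ → Q → ℕ → Prop
  | 0 => P0
  | i + 1 =>
    if i % 2 = 0 then
      fun q ℓ => pruneSeq A E P0 i q ℓ ∧ SubInfBranch (pruneSeq A E P0 i) E q ℓ
    else
      fun q ℓ => pruneSeq A E P0 i q ℓ ∧ ¬ A.FFreeVtx (pruneSeq A E P0 i) E q ℓ

end NBW

namespace NBW

variable {σ Q : Type}

theorem aux_inf_cons {P : Q → ℕ → Prop} {E : Q → ℕ → Q → Prop} {q q' : Q} {l : ℕ}
    (hP : P q l) (hE : E q l q') (h : SubInfBranch P E q' (l + 1)) : SubInfBranch P E q l := by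
  obtain ⟨g, h0, h1, h2⟩ := h
  refine ⟨fun i => Nat.casesOn i q g, rfl, ?_, ?_⟩
  · intro i
    cases i with
    | zero => exact hP
    | succ i =>
      have := h1 i
      rwa [show l + 1 + i = l + (i + 1) by omega] at this
  · intro i
    cases i with
    | zero => simpa [h0] using hE
    | succ i =>
      have := h2 i
      rwa [show l + 1 + i = l + (i + 1) by omega] at this

theorem aux_inf_tail {P : Q → ℕ → Prop} {E : Q → ℕ → Q → Prop} {g : ℕ → Q} {l : ℕ}
    (h1 : ∀ i, P (g i) (l + i)) (h2 : ∀ i, E (g i) (l + i) (g (i + 1))) (k : ℕ) :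
    SubInfBranch P E (g k) (l + k) := by
  refine ⟨fun i => g (k + i), rfl, fun i => ?_, fun i => ?_⟩
  · have := h1 (k + i)
    rwa [← Nat.add_assoc] at this
  · have := h2 (k + i)
    rwa [← Nat.add_assoc] at this

theorem aux_reach_cons {P : Q → ℕ → Prop} {E : Q → ℕ → Q → Prop} {q q1 q' : Q} {l l' : ℕ}
    (hP : P q l) (hE : E q l q1) (h : SubReach P E q1 (l + 1) q' l') : SubReach P E q l q' l' := by
  obtain ⟨n, g, h0, hn, hl, h1, h2⟩ := h
  refine ⟨n + 1, fun i => Nat.casesOn i q g, rfl, hn, by omega, ?_, ?_⟩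
  · intro i hi
    cases i with
    | zero => exact hP
    | succ i =>
      have := h1 i (by omega)
      rwa [show l + 1 + i = l + (i + 1) by omega] at this
  · intro i hi
    cases i with
    | zero => simpa [h0] using hE
    | succ i =>
      have := h2 i (by omega)
      rwa [show l + 1 + i = l + (i + 1) by omega] at this

theorem aux_reach_self {P : Q → ℕ → Prop} {E : Q → ℕ → Q → Prop} {q : Q} {l : ℕ}
    (hP : P q l) : SubReach P E q l q l :=
  ⟨0, fun _ => q, rfl, rfl, rfl, fun i hi => by
    obtain rfl : i = 0 := by omega
    exact hP, fun i hi => by omega⟩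

/-- An accepting vertex can be reached in exactly `n` steps. -/
def AuxDist (A : NBW σ Q) (P : Q → ℕ → Prop) (E : Q → ℕ → Q → Prop) : ℕ → Q → ℕ → Prop
  | 0, q, _ => q ∈ A.acc
  | n + 1, q, l => ∃ q', E q l q' ∧ P q' (l + 1) ∧ AuxDist A P E n q' (l + 1)

theorem aux_dist_of_path (A : NBW σ Q) {P : Q → ℕ → Prop} {E : Q → ℕ → Q → Prop} (n : ℕ) :
    ∀ (g : ℕ → Q) (l : ℕ), g n ∈ A.acc → (∀ i ≤ n, P (g i) (l + i)) →
      (∀ i < n, E (g i) (l + i) (g (i + 1))) → AuxDist A P E n (g 0) l := by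
  induction n with
  | zero => intro g l h _ _; exact h
  | succ n ih =>
    intro g l h h1 h2
    refine ⟨g 1, h2 0 (by omega), h1 1 (by omega), ?_⟩
    refine ih (fun i => g (i + 1)) (l + 1) h (fun i hi => ?_) (fun i hi => ?_)
    · have := h1 (i + 1) (by omega)
      rwa [show l + (i + 1) = l + 1 + i by omega] at this
    · have := h2 (i + 1) (by omega)
      rwa [show l + (i + 1) = l + 1 + i by omega] at this

/-- If every vertex of `P` has a successor in `P` and reaches an accepting vertex, then there is a
branch from any vertex at level 0 visiting accepting vertices infinitely often. -/
theorem aux_branch (A : NBW σ Q) {P : Q → ℕ → Prop} {E : Q → ℕ → Q → Prop}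
    (hs : ∀ q l, P q l → ∃ q', E q l q' ∧ P q' (l + 1))
    (hd : ∀ q l, P q l → ∃ n, AuxDist A P E n q l) (q0 : Q) (h0 : P q0 0) :
    ∃ r : ℕ → Q, r 0 = q0 ∧ (∀ l, E (r l) l (r (l + 1))) ∧ ∀ n, ∃ m, n ≤ m ∧ r m ∈ A.acc := by
  have step : ∀ q l, ∃ q', P q l → E q l q' ∧ P q' (l + 1) ∧
      (q ∈ A.acc ∨ sInf {n | AuxDist A P E n q' (l + 1)} < sInf {n | AuxDist A P E n q l}) := by
    intro q l
    by_cases hP : P q l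
    · by_cases ha : q ∈ A.acc
      · obtain ⟨q', h⟩ := hs q l hP
        exact ⟨q', fun _ => ⟨h.1, h.2, Or.inl ha⟩⟩
      · have hm := Nat.sInf_mem (s := {n | AuxDist A P E n q l}) (hd q l hP)
        generalize sInf {n | AuxDist A P E n q l} = k at hm
        cases k with
        | zero => exact absurd hm ha
        | succ k =>
          obtain ⟨q', h1, h2, h3⟩ := hm
          exact ⟨q', fun _ => ⟨h1, h2, Or.inr (Nat.lt_succ_of_le (Nat.sInf_le h3))⟩⟩
    · exact ⟨q, fun h => absurd h hP⟩
  choose f hf using step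
  let r : ℕ → Q := fun n => Nat.rec q0 (fun l q => f q l) n
  have hr : ∀ l, r (l + 1) = f (r l) l := fun l => rfl
  have hP : ∀ l, P (r l) l := by
    intro l
    induction l with
    | zero => exact h0
    | succ l ih => rw [hr]; exact (hf _ _ ih).2.1
  refine ⟨r, rfl, fun l => ?_, fun n => ?_⟩
  · rw [hr]; exact (hf _ _ (hP l)).1
  · have key : ∀ k l, sInf {n | AuxDist A P E n (r l) l} ≤ k → ∃ m, l ≤ m ∧ r m ∈ A.acc := by
      intro k
      induction k with
      | zero =>
        intro l hl
        rcases (hf _ _ (hP l)).2.2 with h | h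
        · exact ⟨l, le_rfl, h⟩
        · omega
      | succ k ih =>
        intro l hl
        rcases (hf _ _ (hP l)).2.2 with h | h
        · exact ⟨l, le_rfl, h⟩
        · rw [← hr] at h
          obtain ⟨m, hm, hm'⟩ := ih (l + 1) (by omega)
          exact ⟨m, by omega, hm'⟩
    exact key _ n le_rfl

section prune

variable (A : NBW σ Q) (E : Q → ℕ → Q → Prop) (P0 : Q → ℕ → Prop)

theorem aux_even {i : ℕ} (hi : i % 2 = 0) (q : Q) (l : ℕ) : pruneSeq A E P0 (i + 1) q l ↔
    pruneSeq A E P0 i q l ∧ SubInfBranch (pruneSeq A E P0 i) E q l := by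
  rw [pruneSeq, if_pos hi]

theorem aux_odd {i : ℕ} (hi : i % 2 = 1) (q : Q) (l : ℕ) : pruneSeq A E P0 (i + 1) q l ↔
    pruneSeq A E P0 i q l ∧ ¬ A.FFreeVtx (pruneSeq A E P0 i) E q l := by
  rw [pruneSeq, if_neg (by omega)]

theorem aux_mono {i : ℕ} {q : Q} {l : ℕ} (h : pruneSeq A E P0 (i + 1) q l) :
    pruneSeq A E P0 i q l := by
  rcases Nat.mod_two_eq_zero_or_one i with hi | hi
  · exact ((aux_even A E P0 hi q l).1 h).1
  · exact ((aux_odd A E P0 hi q l).1 h).1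

theorem aux_mono_zero {i : ℕ} {q : Q} {l : ℕ} (h : pruneSeq A E P0 i q l) : P0 q l := by
  induction i with
  | zero => exact h
  | succ i ih => exact ih (aux_mono A E P0 h)

theorem aux_odd_inf {i : ℕ} (hi : i % 2 = 1) {q : Q} {l : ℕ} (h : pruneSeq A E P0 i q l) :
    SubInfBranch (pruneSeq A E P0 i) E q l := by
  obtain ⟨j, rfl⟩ : ∃ j, i = j + 1 := ⟨i - 1, by omega⟩
  have hj : j % 2 = 0 := by omega
  obtain ⟨_, g, h0, h1, h2⟩ := (aux_even A E P0 hj q l).1 h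
  exact ⟨g, h0, fun i => (aux_even A E P0 hj _ _).2 ⟨h1 i, aux_inf_tail h1 h2 i⟩, h2⟩

theorem aux_pred (hE : ∀ q l q', E q l q' → P0 q l) (i : ℕ) {q q' : Q} {l : ℕ} (he : E q l q')
    (h : pruneSeq A E P0 i q' (l + 1)) : pruneSeq A E P0 i q l := by
  induction i with
  | zero => exact hE _ _ _ he
  | succ i ih =>
    have hq := ih (aux_mono A E P0 h)
    rcases Nat.mod_two_eq_zero_or_one i with hi | hi
    · rw [aux_even A E P0 hi] at h ⊢
      exact ⟨hq, aux_inf_cons hq he h.2⟩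
    · rw [aux_odd A E P0 hi] at h ⊢
      refine ⟨hq, fun hf => h.2 ⟨aux_odd_inf A E P0 hi h.1, fun q1 l1 hr => ?_⟩⟩
      exact hf.2 q1 l1 (aux_reach_cons hq he hr)

theorem aux_ffree_succ {i : ℕ} (hi : i % 2 = 1) {q q' : Q} {l : ℕ} (he : E q l q')
    (h : A.FFreeVtx (pruneSeq A E P0 i) E q l) (hq : pruneSeq A E P0 i q l)
    (hq' : pruneSeq A E P0 i q' (l + 1)) : A.FFreeVtx (pruneSeq A E P0 i) E q' (l + 1) :=
  ⟨aux_odd_inf A E P0 hi hq', fun q1 l1 hr => h.2 q1 l1 (aux_reach_cons hq he hr)⟩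

end prune

theorem aux_level_zero (A : NBW σ Q) (w : ℕ → σ) (i : ℕ) (l : ℕ) : ∀ q,
    pruneSeq A (A.GEdge w) (fun q l => q ∈ A.levelSet w l) i q l →
    ∃ q0, pruneSeq A (A.GEdge w) (fun q l => q ∈ A.levelSet w l) i q0 0 := by
  induction l with
  | zero => intro q h; exact ⟨q, h⟩
  | succ l ih =>
    intro q h
    have hm : q ∈ A.levelSet w (l + 1) := aux_mono_zero A _ _ h
    simp only [levelSet, dSet, Set.mem_iUnion] at hm
    obtain ⟨p, hp, hpq⟩ := hm
    exact ih p (aux_pred A _ _ (fun _ _ _ h => h.1) i ⟨hp, hpq⟩ h)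

theorem aux_exists_ffree (A : NBW σ Q) (w : ℕ → σ) (hw : w ∉ A.Lang) {i : ℕ} (hi : i % 2 = 1)
    {q : Q} {l : ℕ} (h : pruneSeq A (A.GEdge w) (fun q l => q ∈ A.levelSet w l) i q l) :
    ∃ q l, pruneSeq A (A.GEdge w) (fun q l => q ∈ A.levelSet w l) i q l ∧
      A.FFreeVtx (pruneSeq A (A.GEdge w) (fun q l => q ∈ A.levelSet w l) i) (A.GEdge w) q l := by
  by_contra hcon
  push Not at hcon
  obtain ⟨q0, h0⟩ := aux_level_zero A w i l q h
  obtain ⟨r, hr0, hr1, hr2⟩ := aux_branch A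
    (P := pruneSeq A (A.GEdge w) (fun q l => q ∈ A.levelSet w l) i) (E := A.GEdge w) (by
      intro q l hq
      obtain ⟨g, rfl, h1, h2⟩ := aux_odd_inf A _ _ hi hq
      exact ⟨g 1, h2 0, h1 1⟩) (by
      intro q l hq
      have := hcon q l hq
      unfold FFreeVtx at this
      push Not at this
      obtain ⟨q', l', ⟨n, g, rfl, rfl, _, h1, h2⟩, ha⟩ := this (aux_odd_inf A _ _ hi hq)
      exact ⟨n, aux_dist_of_path A n g l ha h1 h2⟩) q0 h0
  refine hw ⟨r, ⟨?_, fun i => (hr1 i).2⟩, hr2⟩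
  rw [hr0]
  exact aux_mono_zero A _ _ h0

theorem aux_width [Fintype Q] (A : NBW σ Q) (w : ℕ → σ) (hw : w ∉ A.Lang) (i : ℕ)
    (hi : i ≤ Fintype.card Q) : ∃ L, ∀ l, L ≤ l →
      {q | pruneSeq A (A.GEdge w) (fun q l => q ∈ A.levelSet w l) (2 * i) q l}.ncard + i
        ≤ Fintype.card Q := by
  induction i with
  | zero =>
    refine ⟨0, fun l _ => ?_⟩
    rw [← Nat.card_eq_fintype_card]
    exact Set.ncard_le_card _
  | succ i ih =>
    obtain ⟨L, hL⟩ := ih (by omega)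
    have hodd : (2 * i + 1) % 2 = 1 := by omega
    by_cases hne : ∃ q l, pruneSeq A (A.GEdge w) (fun q l => q ∈ A.levelSet w l) (2 * i + 1) q l
    · obtain ⟨q, l, hq⟩ := hne
      obtain ⟨q, l, hq, hf⟩ := aux_exists_ffree A w hw hodd hq
      obtain ⟨g, hg0, h1, h2⟩ := hf.1
      have hff : ∀ k, A.FFreeVtx (pruneSeq A (A.GEdge w) (fun q l => q ∈ A.levelSet w l)
          (2 * i + 1)) (A.GEdge w) (g k) (l + k) := by
        intro k
        induction k with
        | zero => rw [hg0]; exact hf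
        | succ k ihk => exact aux_ffree_succ A _ _ hodd (h2 k) ihk (h1 k) (h1 (k + 1))
      refine ⟨max L l, fun l' hl' => ?_⟩
      obtain ⟨k, rfl⟩ : ∃ k, l' = l + k := ⟨l' - l, by omega⟩
      have h3 := hL (l + k) (by omega)
      have h4 : {q | pruneSeq A (A.GEdge w) (fun q l => q ∈ A.levelSet w l)
            (2 * (i + 1)) q (l + k)}.ncard <
          {q | pruneSeq A (A.GEdge w) (fun q l => q ∈ A.levelSet w l)
            (2 * i) q (l + k)}.ncard := by
        apply Set.ncard_lt_ncard _ (Set.toFinite _)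
        rw [Set.ssubset_iff_of_subset]
        · exact ⟨g k, aux_mono A _ _ (h1 k), fun h => ((aux_odd A _ _ hodd _ _).1 h).2 (hff k)⟩
        · intro q h
          exact aux_mono A _ _ (aux_mono A _ _ h)
      omega
    · refine ⟨0, fun l _ => ?_⟩
      have : {q | pruneSeq A (A.GEdge w) (fun q l => q ∈ A.levelSet w l)
          (2 * (i + 1)) q l} = ∅ := by
        ext q
        simp only [Set.mem_setOf_eq, Set.mem_empty_iff_false, iff_false]
        exact fun h => hne ⟨q, l, aux_mono A _ _ h⟩
      rw [this, Set.ncard_empty]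
      omega

end NBW

/-- `w ∉ L(A)` iff every initial ω-branch of the run DAG of the complete NBW `A`
over `w` eventually gets trapped in odd ranks. -/
theorem NBW.trapped_in_odd_ranks (σ Q : Type) [Fintype σ] [Nonempty σ] [Fintype Q]
    (A : NBW σ Q) (hc : A.Complete) (w : ℕ → σ) :
    w ∉ A.Lang ↔
      ∀ γ : ℕ → Q, A.IsInitOmegaBranch (A.GEdge w) γ →
        ∃ m : ℕ, ∀ l, m ≤ l →
          ∃ i : ℕ, i % 2 = 1 ∧ 1 ≤ i ∧ i ≤ 2 * Fintype.card Q - 1 ∧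
            pruneSeq A (A.GEdge w) (fun q ℓ => q ∈ A.levelSet w ℓ) i (γ l) l ∧
            A.FFreeVtx (pruneSeq A (A.GEdge w) (fun q ℓ => q ∈ A.levelSet w ℓ) i)
              (A.GEdge w) (γ l) l := by
  constructor
  · intro hw γ hγ
    have hlev : ∀ l, γ l ∈ A.levelSet w l := fun l => (hγ.2 l).1
    have hex : ∃ i, ∃ l, ¬ pruneSeq A (A.GEdge w) (fun q ℓ => q ∈ A.levelSet w ℓ) i (γ l) l := by
      obtain ⟨L, hL⟩ := aux_width A w hw _ le_rfl
      refine ⟨2 * Fintype.card Q, L, fun h => ?_⟩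
      have h1 := hL L le_rfl
      have h2 : {q | pruneSeq A (A.GEdge w) (fun q l => q ∈ A.levelSet w l)
          (2 * Fintype.card Q) q L}.ncard = 0 := by omega
      rw [Set.ncard_eq_zero (Set.toFinite _)] at h2
      have h3 : γ L ∈ (∅ : Set Q) := h2 ▸ h
      exact h3
    have hle : Nat.find hex ≤ 2 * Fintype.card Q := by
      apply Nat.find_min'
      obtain ⟨L, hL⟩ := aux_width A w hw _ le_rfl
      refine ⟨L, fun h => ?_⟩
      have h1 := hL L le_rfl
      have h2 : {q | pruneSeq A (A.GEdge w) (fun q l => q ∈ A.levelSet w l)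
          (2 * Fintype.card Q) q L}.ncard = 0 := by omega
      rw [Set.ncard_eq_zero (Set.toFinite _)] at h2
      have h3 : γ L ∈ (∅ : Set Q) := h2 ▸ h
      exact h3
    have hspec := Nat.find_spec hex
    have hmin := fun m => Nat.find_min hex (m := m)
    generalize Nat.find hex = k at hle hspec hmin
    cases k with
    | zero =>
      obtain ⟨l, hl⟩ := hspec
      exact absurd (hlev l) hl
    | succ j =>
      have hj := hmin j (by omega)
      push Not at hj
      obtain ⟨m, hm⟩ := hspec
      rcases Nat.mod_two_eq_zero_or_one j with hj2 | hj2
      · refine absurd ((aux_even A _ _ hj2 _ _).2 ⟨hj m, ?_⟩) hm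
        have := aux_inf_tail (P := pruneSeq A (A.GEdge w) (fun q ℓ => q ∈ A.levelSet w ℓ) j)
          (E := A.GEdge w) (g := γ) (l := 0) (fun i => by rw [Nat.zero_add]; exact hj i)
          (fun i => by rw [Nat.zero_add]; exact hγ.2 i) m
        rwa [Nat.zero_add] at this
      · refine ⟨m, fun l hl => ⟨j, hj2, by omega, by omega, hj l, ?_⟩⟩
        have hn : ¬ pruneSeq A (A.GEdge w) (fun q ℓ => q ∈ A.levelSet w ℓ) (j + 1) (γ l) l := by
          induction l, hl using Nat.le_induction with
          | base => exact hm
          | succ l _ ih =>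
            exact fun h => ih (aux_pred A _ _ (fun _ _ _ h => h.1) _ (hγ.2 l) h)
        by_contra hf
        exact hn ((aux_odd A _ _ hj2 _ _).2 ⟨hj l, hf⟩)
  · rintro h ⟨ρ, ⟨h0, h1⟩, h2⟩
    have hlev : ∀ l, ρ l ∈ A.levelSet w l := by
      intro l
      induction l with
      | zero => exact h0
      | succ l ih =>
        simp only [levelSet, dSet, Set.mem_iUnion]
        exact ⟨ρ l, ih, h1 l⟩
    obtain ⟨m, hm⟩ := h ρ ⟨h0, fun l => ⟨hlev l, h1 l⟩⟩
    obtain ⟨l, hl, ha⟩ := h2 m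
    obtain ⟨i, _, _, _, hp, hf⟩ := hm l hl
    exact hf.2 _ _ (aux_reach_self hp) ha
end

section
/- Let A be a complete finitely ambiguous NBW with a fixed enumeration of its states, let w be an ω-word, let Ḡ be the reduced run DAG of A over w, and let Ḡ^0 = Ḡ, Ḡ^1, Ḡ^2, Ḡ^3 be the first four terms of the pruning sequence of Ḡ. Then w ∉ L(A) if and only if Ḡ^3 has no vertices. -/
open scoped Classical

namespace NBW

section helpers

variable {σ Q : Type}

theorem redEdge_unique (A : NBW σ Q) [LinearOrder Q] (w : ℕ → σ) {p p' q : Q} {l : ℕ}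
    (h : A.RedEdge w p l q) (h' : A.RedEdge w p' l q) : p = p' :=
  le_antisymm (h.2.2 p' h'.1 h'.2.1) (h'.2.2 p h.1 h.2.1)

theorem back_det (A : NBW σ Q) [LinearOrder Q] (w : ℕ → σ) (a b : ℕ → Q) (j : ℕ) :
    ∀ n, (∀ i < n, A.RedEdge w (a i) (j + i) (a (i + 1))) →
      (∀ i < n, A.RedEdge w (b i) (j + i) (b (i + 1))) → a n = b n → a 0 = b 0 := by
  intro n
  induction n with
  | zero => intro _ _ h; exact h
  | succ n ih =>
    intro ha hb h
    refine ih (fun i hi => ha i (by omega)) (fun i hi => hb i (by omega)) ?_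
    have h1 := ha n (by omega)
    have h2 := hb n (by omega)
    rw [← h] at h2
    exact A.redEdge_unique w h1 h2

theorem exists_pred (A : NBW σ Q) [Fintype Q] [LinearOrder Q] (w : ℕ → σ) (l : ℕ) (q : Q)
    (h : q ∈ A.levelSet w (l + 1)) : ∃ p, A.RedEdge w p l q := by
  have hne : ({p | p ∈ A.levelSet w l ∧ q ∈ A.trans p (w l)} : Set Q).Nonempty := by
    simp only [levelSet, dSet, Set.mem_iUnion] at h
    obtain ⟨p, hp, hq⟩ := h
    exact ⟨p, hp, hq⟩
  obtain ⟨p, hp, hmin⟩ := Set.exists_min_image _ id (Set.toFinite _) hne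
  exact ⟨p, hp.1, hp.2, fun p' h1 h2 => hmin p' ⟨h1, h2⟩⟩

theorem exists_prefix (A : NBW σ Q) [Fintype Q] [LinearOrder Q] (w : ℕ → σ) (l : ℕ) :
    ∀ q ∈ A.levelSet w l, ∃ a : ℕ → Q, a 0 ∈ A.init ∧ a l = q ∧
      ∀ i < l, A.RedEdge w (a i) i (a (i + 1)) := by
  induction l with
  | zero => intro q hq; exact ⟨fun _ => q, hq, rfl, fun i hi => absurd hi (by omega)⟩
  | succ l ih =>
    intro q hq
    obtain ⟨p, hp⟩ := A.exists_pred w l q hq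
    obtain ⟨a, h0, hl, ha⟩ := ih p hp.1
    refine ⟨fun i => if i ≤ l then a i else q, by simpa using h0, by simp, fun i hi => ?_⟩
    rcases Nat.lt_or_ge i l with h | h
    · have h1 : i ≤ l := by omega
      have h2 : i + 1 ≤ l := by omega
      simpa [h1, h2] using ha i h
    · have h1 : i = l := by omega
      subst h1
      simpa [hl] using hp

/-- Full branches of the reduced run DAG. -/
def FullBr (A : NBW σ Q) [LinearOrder Q] (w : ℕ → σ) (ρ : ℕ → Q) : Prop :=
  ρ 0 ∈ A.init ∧ ∀ i, A.RedEdge w (ρ i) i (ρ (i + 1))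

theorem exists_full (A : NBW σ Q) [Fintype Q] [LinearOrder Q] (w : ℕ → σ) (l : ℕ) (q : Q)
    (hq : q ∈ A.levelSet w l) (γ : ℕ → Q) (h0 : γ 0 = q)
    (hγ : ∀ i, A.RedEdge w (γ i) (l + i) (γ (i + 1))) :
    ∃ ρ, A.FullBr w ρ ∧ ∀ i, ρ (l + i) = γ i := by
  obtain ⟨a, ha0, hal, ha⟩ := A.exists_prefix w l q hq
  refine ⟨fun i => if i ≤ l then a i else γ (i - l), ⟨by simpa using ha0, fun i => ?_⟩, ?_⟩
  · rcases Nat.lt_or_ge i l with h | h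
    · have h1 : i ≤ l := by omega
      have h2 : i + 1 ≤ l := by omega
      simpa [h1, h2] using ha i h
    · obtain ⟨k, rfl⟩ := Nat.exists_eq_add_of_le h
      have := hγ k
      rcases k with _ | k
      · simpa [hal, ← h0] using this
      · have e : l + (k + 1) + 1 - l = k + 1 + 1 := by omega
        have e2 : ¬ (l + (k + 1) + 1 ≤ l) := by omega
        simpa [e, e2] using this
  · intro i
    rcases i with _ | i
    · simp [hal, h0]
    · simp

theorem FullBr.agree {A : NBW σ Q} [LinearOrder Q] {w : ℕ → σ} {ρ τ : ℕ → Q}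
    (h : A.FullBr w ρ) (h' : A.FullBr w τ) {m j : ℕ} (hj : j ≤ m) (e : ρ m = τ m) :
    ρ j = τ j := by
  obtain ⟨n, rfl⟩ := Nat.exists_eq_add_of_le hj
  exact A.back_det w (fun i => ρ (j + i)) (fun i => τ (j + i)) j n
    (fun i _ => h.2 (j + i)) (fun i _ => h'.2 (j + i)) e

theorem finite_full (A : NBW σ Q) [Fintype Q] [LinearOrder Q] (w : ℕ → σ) :
    {ρ | A.FullBr w ρ}.Finite := by
  by_contra hinf
  obtain ⟨T, hT, hcard⟩ := Set.Infinite.exists_subset_card_eq hinf (Fintype.card Q + 1)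
  have hd : ∀ p : (ℕ → Q) × (ℕ → Q), ∃ i, p.1 ≠ p.2 → p.1 i ≠ p.2 i := by
    intro p
    by_cases h : p.1 = p.2
    · exact ⟨0, fun h' => absurd h h'⟩
    · obtain ⟨i, hi⟩ := Function.ne_iff.1 h
      exact ⟨i, fun _ => hi⟩
  choose d hd using hd
  let m := (T ×ˢ T).sup d
  have hinj : Set.InjOn (fun ρ : ℕ → Q => ρ m) (T : Set (ℕ → Q)) := by
    intro ρ hρ τ hτ e
    by_contra hne
    refine hd (ρ, τ) hne (FullBr.agree (hT hρ) (hT hτ) (m := m) ?_ e)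
    exact Finset.le_sup (f := d) (Finset.mem_product.2 ⟨hρ, hτ⟩)
  have := Finset.card_le_card_of_injOn (t := Finset.univ) (fun ρ : ℕ → Q => ρ m)
    (fun _ _ => Finset.mem_coe.2 (Finset.mem_univ _)) hinj
  rw [hcard, Finset.card_univ] at this
  omega

theorem FullBr.mem_level {A : NBW σ Q} [LinearOrder Q] {w : ℕ → σ} {ρ : ℕ → Q}
    (h : A.FullBr w ρ) (i : ℕ) : ρ i ∈ A.levelSet w i := (h.2 i).1

theorem run_mem_level {A : NBW σ Q} {w : ℕ → σ} {ρ : ℕ → Q}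
    (h : A.IsRun w ρ) (i : ℕ) : ρ i ∈ A.levelSet w i := by
  induction i with
  | zero => exact h.1
  | succ i ih =>
    simp only [levelSet, dSet, Set.mem_iUnion]
    exact ⟨_, ih, h.2 i⟩

theorem FullBr.isRun {A : NBW σ Q} [LinearOrder Q] {w : ℕ → σ} {ρ : ℕ → Q}
    (h : A.FullBr w ρ) : A.IsRun w ρ := ⟨h.1, fun i => (h.2 i).2.1⟩

/-- An accepted word has an accepting branch in the reduced run DAG. -/
theorem exists_acc_full (A : NBW σ Q) [Fintype Q] [LinearOrder Q] (w : ℕ → σ)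
    (hfa : A.FinitelyAmbiguous) (hw : w ∈ A.Lang) :
    ∃ ρ, A.FullBr w ρ ∧ ∀ n, ∃ m, n ≤ m ∧ ρ m ∈ A.acc := by
  obtain ⟨ρ, hρ, hacc⟩ := id hw
  have key : ∀ l, ∃ τ, A.IsAccRun w τ ∧ ∀ i < l, A.RedEdge w (τ i) i (τ (i + 1)) := by
    intro l
    obtain ⟨a, ha0, hal, ha⟩ := A.exists_prefix w l (ρ l) (run_mem_level hρ l)
    have hr : ∀ i < l, A.RedEdge w (if i ≤ l then a i else ρ i) i
        (if i + 1 ≤ l then a (i + 1) else ρ (i + 1)) := by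
      intro i h
      have h1 : i ≤ l := by omega
      have h2 : i + 1 ≤ l := by omega
      simpa [h1, h2] using ha i h
    refine ⟨fun i => if i ≤ l then a i else ρ i, ⟨⟨by simpa using ha0, fun i => ?_⟩, ?_⟩, hr⟩
    · rcases Nat.lt_or_ge i l with h | h
      · exact (hr i h).2.1
      · have h2 : ¬ (i + 1 ≤ l) := by omega
        have e : (if i ≤ l then a i else ρ i) = ρ i := by
          split_ifs with h3
          · have : i = l := by omega
            rw [this, hal]
          · rfl
        simp only [h2, if_false, e]
        exact hρ.2 i
    · intro n
      obtain ⟨m, hm, hm'⟩ := hacc (max n (l + 1))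
      refine ⟨m, by omega, ?_⟩
      have h2 : ¬ (m ≤ l) := by omega
      simpa [h2] using hm'
  choose τ hτ hred using key
  have := (hfa w hw).to_subtype
  obtain ⟨⟨ρ', hρ'⟩, hinf⟩ := Finite.exists_infinite_fiber
    (fun l => (⟨τ l, hτ l⟩ : {ρ | A.IsAccRun w ρ}))
  rw [Set.infinite_coe_iff] at hinf
  refine ⟨ρ', ⟨hρ'.1.1, fun i => ?_⟩, hρ'.2⟩
  obtain ⟨l, hl, hil⟩ := hinf.exists_gt i
  have e : τ l = ρ' := congrArg Subtype.val hl
  rw [← e]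
  exact hred l i hil

end helpers

end NBW

/-- For a complete FANBW `A`, `w ∉ L(A)` iff the third pruning stage `Ḡ³` of the
reduced run DAG `Ḡ` of `A` over `w` has no vertices. -/
theorem NBW.reduced_pruning_empty (σ Q : Type) [Fintype σ] [Nonempty σ]
    [Fintype Q] [LinearOrder Q] (A : NBW σ Q)
    (hc : A.Complete) (hfa : A.FinitelyAmbiguous) (w : ℕ → σ) :
    w ∉ A.Lang ↔
      ∀ q ℓ, ¬ pruneSeq A (A.RedEdge w) (fun q ℓ => q ∈ A.levelSet w ℓ) 3 q ℓ := by
  set P := pruneSeq A (A.RedEdge w) (fun q ℓ => q ∈ A.levelSet w ℓ) with hP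
  have p1 : ∀ q l, P 1 q l ↔ q ∈ A.levelSet w l ∧
      SubInfBranch (fun q ℓ => q ∈ A.levelSet w ℓ) (A.RedEdge w) q l := by
    intro q l; simp [hP, pruneSeq]
  have p2 : ∀ q l, P 2 q l ↔ P 1 q l ∧ ¬ A.FFreeVtx (P 1) (A.RedEdge w) q l := by
    intro q l; simp [hP, pruneSeq]
  have p3 : ∀ q l, P 3 q l ↔ P 2 q l ∧ SubInfBranch (P 2) (A.RedEdge w) q l := by
    intro q l; simp [hP, pruneSeq]
  constructor
  · intro hw q l h3
    obtain ⟨h2, γ, hγ0, hγP, hγE⟩ := (p3 q l).1 h3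
    have hq : q ∈ A.levelSet w l := ((p1 q l).1 ((p2 q l).1 h2).1).1
    obtain ⟨ρ, hρ, hργ⟩ := A.exists_full w l q hq γ hγ0 hγE
    have hnacc : ∃ N, ∀ m, N ≤ m → ρ m ∉ A.acc := by
      by_contra hcon
      push Not at hcon
      exact hw ⟨ρ, hρ.isRun, hcon⟩
    obtain ⟨N, hN⟩ := hnacc
    have hd : ∀ τ : ℕ → Q, ∃ i, τ ≠ ρ → τ i ≠ ρ i := by
      intro τ
      by_cases h : τ = ρ
      · exact ⟨0, fun h' => absurd h h'⟩
      · obtain ⟨i, hi⟩ := Function.ne_iff.1 h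
        exact ⟨i, fun _ => hi⟩
    choose d hd using hd
    obtain ⟨M, hM⟩ := ((A.finite_full w).image d).bddAbove
    let k := N + M
    have hk := hγP k
    obtain ⟨hk1, hk2⟩ := (p2 _ _).1 hk
    apply hk2
    refine ⟨⟨fun i => γ (k + i), rfl, fun i => ?_, fun i => ?_⟩, ?_⟩
    · have := ((p2 _ _).1 (hγP (k + i))).1
      rwa [← add_assoc] at this
    · have := hγE (k + i)
      rwa [← add_assoc] at this
    · rintro q' l' ⟨n, δ, hδ0, hδn, rfl, hδP, hδE⟩ hacc
      obtain ⟨hq', β, hβ0, -, hβE⟩ := (p1 _ _).1 (hδP n le_rfl)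
      rw [hδn] at hβ0
      rw [hδn] at hq'
      obtain ⟨τ, hτ, hτβ⟩ := A.exists_full w _ q' hq' β hβ0 hβE
      have hτn : τ (l + k + n) = q' := by have := hτβ 0; rwa [add_zero, hβ0] at this
      have e : τ (l + k) = ρ (l + k) := by
        have := A.back_det w (fun i => τ (l + k + i)) δ (l + k) n
          (fun i _ => hτ.2 (l + k + i)) hδE (by simp [hτn, hδn])
        rw [hργ, ← hδ0, ← this, add_zero]
      have hτρ : τ = ρ := by
        by_contra hne
        have hdM : d τ ≤ M := hM ⟨τ, hτ, rfl⟩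
        exact hd τ hne (hτ.agree hρ (by omega) e)
      refine hN (l + k + n) (by omega) ?_
      rw [← hτρ, hτn]
      exact hacc
  · intro h hw
    obtain ⟨ρ, hρ, hacc⟩ := A.exists_acc_full w hfa hw
    have inf : ∀ R : Q → ℕ → Prop, (∀ i, R (ρ i) i) →
        ∀ i, SubInfBranch R (A.RedEdge w) (ρ i) i := fun R hR i =>
      ⟨fun j => ρ (i + j), rfl, fun j => hR _, fun j => hρ.2 (i + j)⟩
    have h1 : ∀ i, P 1 (ρ i) i := fun i =>
      (p1 _ _).2 ⟨hρ.mem_level i, inf _ hρ.mem_level i⟩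
    have h2 : ∀ i, P 2 (ρ i) i := by
      intro i
      refine (p2 _ _).2 ⟨h1 i, fun hf => ?_⟩
      obtain ⟨m, hm, hm'⟩ := hacc i
      obtain ⟨n, rfl⟩ := Nat.exists_eq_add_of_le hm
      exact hf.2 _ (i + n) ⟨n, fun j => ρ (i + j), rfl, rfl, rfl, fun j _ => h1 _,
        fun j _ => hρ.2 (i + j)⟩ hm'
    exact h (ρ 0) 0 ((p3 _ _).2 ⟨h2 0, inf _ h2 0⟩)
end

section
/- Let A be a complete finitely ambiguous NBW with a fixed enumeration of its states, let w be an ω-word, let Ḡ be the reduced run DAG of A over w, and let Ḡ^0 = Ḡ, Ḡ^1, Ḡ^2, Ḡ^3 be the first four terms of the pruning sequence of Ḡ. Then w ∉ L(A) if and only if every initial ω-branch of Ḡ eventually gets trapped in odd ranks, i.e., for every initial ω-branch γ of Ḡ there exists m ∈ ℕ such that for every l ≥ m the vertex γ(l) is an F-free vertex of Ḡ^1. -/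
open scoped Classical

namespace NBW

/-- Every vertex of the reduced run DAG is reached by a reduced path from an initial state. -/
theorem aux_path {σ Q : Type} [Fintype Q] [LinearOrder Q] (A : NBW σ Q) (w : ℕ → σ) (l : ℕ) :
    ∀ q ∈ A.levelSet w l, ∃ p : ℕ → Q, p 0 ∈ A.init ∧ p l = q ∧
      ∀ i < l, A.RedEdge w (p i) i (p (i + 1)) := by
  induction l with
  | zero => 
    intro q hq
    exact ⟨fun _ => q, hq, rfl, fun i hi => absurd hi (Nat.not_lt_zero i)⟩
  | succ l ih =>
    intro q hq
    have hne : {p | p ∈ A.levelSet w l ∧ q ∈ A.trans p (w l)}.Nonempty := by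
      simp only [levelSet, dSet, Set.mem_iUnion] at hq
      obtain ⟨p, hp, hpq⟩ := hq
      exact ⟨p, hp, hpq⟩
    obtain ⟨a, ha, hmin⟩ := Set.exists_min_image _ id (Set.toFinite _) hne
    obtain ⟨p, h0, hl, he⟩ := ih a ha.1
    refine ⟨fun i => if i ≤ l then p i else q, by simpa using h0, by simp, ?_⟩
    intro i hi
    rcases Nat.lt_succ_iff_lt_or_eq.mp hi with h | h
    · have h1 : i ≤ l := h.le
      have h2 : i + 1 ≤ l := h
      simp only [h1, h2, if_true]
      exact he i h
    · subst h
      simp only [le_refl, if_true, Nat.not_succ_le_self, if_false, hl]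
      exact ⟨ha.1, ha.2, fun p hp hq => hmin p ⟨hp, hq⟩⟩

theorem aux_run_level {σ Q : Type} (A : NBW σ Q) (w : ℕ → σ) (ρ : ℕ → Q) (h : A.IsRun w ρ) :
    ∀ l, ρ l ∈ A.levelSet w l := by
  intro l
  induction l with
  | zero => exact h.1
  | succ l ih =>
    simp only [levelSet, dSet, Set.mem_iUnion]
    exact ⟨ρ l, ih, h.2 l⟩

/-- An accepted word has an accepting branch in the reduced run DAG. -/
theorem aux_acc {σ Q : Type} [Fintype Q] [LinearOrder Q] (A : NBW σ Q)
    (hfa : A.FinitelyAmbiguous) (w : ℕ → σ) (hw : w ∈ A.Lang) :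
    ∃ r, A.IsInitOmegaBranch (A.RedEdge w) r ∧ A.IsAcceptingBranch r := by
  have hfin := hfa w hw
  obtain ⟨ρ, hρ, hacc⟩ := hw
  have hlev := aux_run_level A w ρ hρ
  choose p h0 hl he using fun l => aux_path A w l (ρ l) (hlev l)
  let r : ℕ → ℕ → Q := fun l i => if i ≤ l then p l i else ρ i
  have hr : ∀ l, A.IsAccRun w (r l) := by
    intro l
    refine ⟨⟨by simpa [r] using h0 l, ?_⟩, ?_⟩
    · intro i
      rcases lt_trichotomy i l with h | h | h
      · have h1 : i ≤ l := h.le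
        have h2 : i + 1 ≤ l := h
        simp only [r, h1, h2, if_true]
        exact (he l i h).2.1
      · subst h
        simp only [r, le_refl, if_true, Nat.not_succ_le_self, if_false, hl]
        exact hρ.2 i
      · have h1 : ¬ i ≤ l := by omega
        have h2 : ¬ i + 1 ≤ l := by omega
        simp only [r, h1, h2, if_false]
        exact hρ.2 i
    · intro n
      obtain ⟨m, hm, hm'⟩ := hacc (max n (l + 1))
      refine ⟨m, by omega, ?_⟩
      have h1 : ¬ m ≤ l := by omega
      simpa only [r, h1, if_false] using hm'
  have : Finite {ρ | A.IsAccRun w ρ} := hfin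
  obtain ⟨⟨s, hs⟩, hinf⟩ := Finite.exists_infinite_fiber
    (fun l : ℕ => (⟨r l, hr l⟩ : {ρ | A.IsAccRun w ρ}))
  rw [Set.infinite_coe_iff] at hinf
  refine ⟨s, ⟨hs.1.1, ?_⟩, hs.2⟩
  intro i
  obtain ⟨l, hl1, hl2⟩ := hinf.exists_gt i
  have hrs : r l = s := congrArg Subtype.val hl1
  rw [← hrs]
  have h1 : i ≤ l := hl2.le
  have h2 : i + 1 ≤ l := hl2
  simp only [r, h1, h2, if_true]
  exact he l i hl2

/-- In a forest of bounded width all of whose vertices have children, branching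
eventually stops. -/
theorem aux_stable {Q : Type} [Fintype Q] (P : Q → ℕ → Prop) (E : Q → ℕ → Q → Prop)
    (huniq : ∀ a b l c, E a l c → E b l c → a = b)
    (hchild : ∀ q l, P q l → ∃ q', E q l q' ∧ P q' (l + 1)) :
    ∃ K, ∀ k, K ≤ k → ∀ q a b, E q k a → P a (k + 1) → E q k b → P b (k + 1) → a = b := by
  choose! f hfE hfP using hchild
  let S : ℕ → Set Q := fun k => {q | P q k}
  have hmaps : ∀ k, Set.MapsTo (fun q => f q k) (S k) (S (k + 1)) := fun k q hq => hfP q k hq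
  have hinj : ∀ k, Set.InjOn (fun q => f q k) (S k) := by
    intro k a ha b hb hab
    have h1 := hfE a k ha
    have h2 := hfE b k hb
    have hab' : f a k = f b k := hab
    rw [← hab'] at h2
    exact huniq _ _ _ _ h1 h2
  have hmono : Monotone (fun k => (S k).ncard) := monotone_nat_of_le_succ fun k =>
    Set.ncard_le_ncard_of_injOn _ (hmaps k) (hinj k) (Set.toFinite _)
  have hbd : ∀ k, (S k).ncard ≤ Nat.card Q := fun k => Set.ncard_le_card _
  obtain ⟨x, ⟨K, rfl⟩, hK⟩ := wellFounded_lt.has_min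
    (Set.range fun k => Nat.card Q - (S k).ncard) ⟨_, 0, rfl⟩
  have hK' : ∀ k, (S k).ncard ≤ (S K).ncard := by
    intro k
    have h1 := hK _ ⟨k, rfl⟩
    have h2 := hbd k
    have h3 := hbd K
    simp only at h1
    omega
  refine ⟨K, fun k hk q a b ha hPa hb hPb => ?_⟩
  have hcard : (S (k + 1)).ncard ≤ (S k).ncard := (hK' (k + 1)).trans (hmono hk)
  have himg : (fun q => f q k) '' S k = S (k + 1) := by
    apply Set.eq_of_subset_of_ncard_le (hmaps k).image_subset _ (Set.toFinite _)
    rw [Set.ncard_image_of_injOn (hinj k)]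
    exact hcard
  have key : ∀ c, E q k c → P c (k + 1) → c = f q k := by
    intro c hc hPc
    have hcS : c ∈ S (k + 1) := hPc
    rw [← himg] at hcS
    obtain ⟨p, hp, hpc⟩ := hcS
    have hpc' : f p k = c := hpc
    have h1 := hfE p k hp
    rw [hpc'] at h1
    rw [huniq _ _ _ _ hc h1, hpc']
  rw [key a ha hPa, key b hb hPb]

end NBW

/-- For a complete FANBW `A`, `w ∉ L(A)` iff every initial ω-branch of the reduced
run DAG `Ḡ` of `A` over `w` eventually consists of `F`-free vertices of `Ḡ¹`. -/
theorem NBW.reduced_trapped_in_odd_ranks (σ Q : Type) [Fintype σ] [Nonempty σ]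
    [Fintype Q] [LinearOrder Q] (A : NBW σ Q)
    (hc : A.Complete) (hfa : A.FinitelyAmbiguous) (w : ℕ → σ) :
    w ∉ A.Lang ↔
      ∀ γ : ℕ → Q, A.IsInitOmegaBranch (A.RedEdge w) γ →
        ∃ m : ℕ, ∀ l, m ≤ l →
          pruneSeq A (A.RedEdge w) (fun q ℓ => q ∈ A.levelSet w ℓ) 1 (γ l) l ∧
          A.FFreeVtx (pruneSeq A (A.RedEdge w) (fun q ℓ => q ∈ A.levelSet w ℓ) 1)
            (A.RedEdge w) (γ l) l := by
  set E := A.RedEdge w with hE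
  set P0 : Q → ℕ → Prop := fun q ℓ => q ∈ A.levelSet w ℓ with hP0
  set P := pruneSeq A E P0 1 with hP
  have hPiff : ∀ q l, P q l ↔ (P0 q l ∧ SubInfBranch P0 E q l) := fun q l => Iff.rfl
  constructor
  · intro hw γ hγ
    have hrun : A.IsRun w γ := ⟨hγ.1, fun i => (hγ.2 i).2.1⟩
    have hlev : ∀ l, P0 (γ l) l := aux_run_level A w γ hrun
    have hγP : ∀ l, P (γ l) l := fun l =>
      (hPiff _ _).2 ⟨hlev l, fun i => γ (l + i), rfl, fun i => hlev _, fun i => hγ.2 _⟩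
    obtain ⟨N, hN⟩ : ∃ N, ∀ m, N ≤ m → γ m ∉ A.acc := by
      by_contra hcon
      push Not at hcon
      exact hw ⟨γ, hrun, hcon⟩
    have huniq : ∀ a b l c, E a l c → E b l c → a = b := fun a b l c ha hb =>
      le_antisymm (ha.2.2 b hb.1 hb.2.1) (hb.2.2 a ha.1 ha.2.1)
    have hchild : ∀ q l, P q l → ∃ q', E q l q' ∧ P q' (l + 1) := by
      intro q l hq
      obtain ⟨_, δ, h0, h1, h2⟩ := (hPiff _ _).1 hq
      refine ⟨δ 1, by simpa [h0] using h2 0, (hPiff _ _).2 ⟨h1 1, fun i => δ (i + 1), rfl, ?_, ?_⟩⟩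
      · intro i
        have := h1 (i + 1)
        rwa [show l + (i + 1) = l + 1 + i by omega] at this
      · intro i
        have := h2 (i + 1)
        rwa [show l + (i + 1) = l + 1 + i by omega] at this
    obtain ⟨K, hK⟩ := aux_stable P E huniq hchild
    refine ⟨max K N, fun l hl => ⟨hγP l,
      ⟨fun i => γ (l + i), rfl, fun i => hγP _, fun i => hγ.2 _⟩, ?_⟩⟩
    rintro q' l' ⟨n, δ, h0, hn, -, hδP, hδE⟩
    have hfollow : ∀ i, i ≤ n → δ i = γ (l + i) := by
      intro i
      induction i with
      | zero => intro _; simpa using h0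
      | succ i ih =>
        intro hi
        have hi' := ih (by omega)
        have e := hδE i (by omega)
        rw [hi'] at e
        exact hK (l + i) (by omega) _ _ _ e (hδP (i + 1) hi) (hγ.2 (l + i)) (hγP _)
    rw [← hn, hfollow n le_rfl]
    exact hN _ (by omega)
  · intro h hw
    obtain ⟨r, hr, hacc⟩ := aux_acc A hfa w hw
    obtain ⟨m, hm⟩ := h r hr
    obtain ⟨l, hl, hlacc⟩ := hacc m
    obtain ⟨hPl, _, hfree⟩ := hm l hl
    refine hfree (r l) l ⟨0, fun _ => r l, rfl, rfl, rfl, ?_, ?_⟩ hlacc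
    · intro i hi
      obtain rfl : i = 0 := by omega
      exact hPl
    · intro i hi
      exact absurd hi (Nat.not_lt_zero i)
end

section
/- Let A be a complete NBW over Σ that is limit deterministic with partition (Q_N, Q_D), fix a linear order ≼ on Q in which every element of Q_D precedes every element of Q_N, let w be an ω-word, and let Ĝ be the LDBW run DAG of A over w. Then every vertex of Ĝ has at most one incoming edge; that is, Ĝ is codeterministic. -/
open scoped Classical

namespace NBW

variable {σ Q : Type}

/-- `S_ℓ`: the nondeterministic states reached at level `ℓ`. -/
def ldS (A : NBW σ Q) (QN : Set Q) (w : ℕ → σ) : ℕ → Set Q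
  | 0 => A.init ∩ QN
  | ℓ + 1 => (⋃ q ∈ ldS A QN w ℓ, A.trans q (w ℓ)) ∩ QN

/-- `P_ℓ`: the deterministic states present at level `ℓ`. -/
def ldP (A : NBW σ Q) (QN QD : Set Q) (dD : Q → σ → Q) (w : ℕ → σ) : ℕ → Set Q
  | 0 => A.init ∩ QD
  | ℓ + 1 =>
    ((fun q => dD q (w ℓ)) '' ldP A QN QD dD w ℓ) ∪
      (((⋃ q ∈ ldS A QN w ℓ, A.trans q (w ℓ)) ∩ QD) \
        ((fun q => dD q (w ℓ)) '' ldP A QN QD dD w ℓ))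

/-- `D_{ℓ+1}`: the `δ_D`-successors of `P_ℓ`. -/
def ldD (A : NBW σ Q) (QN QD : Set Q) (dD : Q → σ → Q) (w : ℕ → σ) (ℓ : ℕ) : Set Q :=
  (fun q => dD q (w ℓ)) '' ldP A QN QD dD w ℓ

/-- `J_{ℓ+1}`: the deterministic states freshly reached by a jump from `S_ℓ`. -/
def ldJ (A : NBW σ Q) (QN QD : Set Q) (dD : Q → σ → Q) (w : ℕ → σ) (ℓ : ℕ) : Set Q :=
  ((⋃ q ∈ ldS A QN w ℓ, A.trans q (w ℓ)) ∩ QD) \ ldD A QN QD dD w ℓ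

/-- Priorities at level `ℓ`: the first component gives the priority of a
deterministic vertex `⟨q, ℓ⟩` and the second component the priority of the
nondeterministic vertex `⟨S_ℓ, ℓ⟩`. -/
noncomputable def ldPr (A : NBW σ Q) [LinearOrder Q] (QN QD : Set Q) (dD : Q → σ → Q)
    (w : ℕ → σ) : ℕ → (Q → ℕ) × ℕ
  | 0 =>
    (fun q => {q' ∈ A.init ∩ QD | q' ≤ q}.ncard, (A.init ∩ QD).ncard + 1)
  | ℓ + 1 =>
    (fun q =>
      if q ∈ ldD A QN QD dD w ℓ then
        sInf ((ldPr A QN QD dD w ℓ).1 '' {q' ∈ ldP A QN QD dD w ℓ | dD q' (w ℓ) = q})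
      else (ldPr A QN QD dD w ℓ).2 + {j ∈ ldJ A QN QD dD w ℓ | j ≤ q}.ncard - 1,
     (ldPr A QN QD dD w ℓ).2 + (ldJ A QN QD dD w ℓ).ncard)

/-- The vertices of the LDBW run DAG `Ĝ` at level `ℓ`: `some q` is the deterministic
vertex `⟨q, ℓ⟩`, `none` is the nondeterministic vertex `⟨S_ℓ, ℓ⟩`. -/
def ldVtx (A : NBW σ Q) (QN QD : Set Q) (dD : Q → σ → Q) (w : ℕ → σ)
    (v : Option Q) (ℓ : ℕ) : Prop :=
  match v with
  | some q => q ∈ ldP A QN QD dD w ℓ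
  | none => (ldS A QN w ℓ).Nonempty

/-- The edges of the LDBW run DAG `Ĝ`, from a vertex at level `ℓ` to one at level
`ℓ+1`. -/
def ldEdge (A : NBW σ Q) [LinearOrder Q] (QN QD : Set Q) (dD : Q → σ → Q)
    (w : ℕ → σ) (u : Option Q) (ℓ : ℕ) (v : Option Q) : Prop :=
  match u, v with
  | none, none => (ldS A QN w ℓ).Nonempty ∧ (ldS A QN w (ℓ + 1)).Nonempty
  | none, some j => (ldS A QN w ℓ).Nonempty ∧ j ∈ ldJ A QN QD dD w ℓ
  | some q, some d =>
      q ∈ ldP A QN QD dD w ℓ ∧ d = dD q (w ℓ) ∧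
        (ldPr A QN QD dD w (ℓ + 1)).1 d = (ldPr A QN QD dD w ℓ).1 q
  | some _, none => False

/-- `γ` is an initial ω-branch of `Ĝ` (an ω-branch starting at level `0`). -/
def ldInitOmegaBranch (A : NBW σ Q) [LinearOrder Q] (QN QD : Set Q)
    (dD : Q → σ → Q) (w : ℕ → σ) (γ : ℕ → Option Q) : Prop :=
  (∀ ℓ, ldVtx A QN QD dD w (γ ℓ) ℓ) ∧
    ∀ ℓ, ldEdge A QN QD dD w (γ ℓ) ℓ (γ (ℓ + 1))

/-- The branch `γ` of `Ĝ` is accepting: it contains infinitely many `F`-vertices. -/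
def ldAcceptingBranch (A : NBW σ Q) (γ : ℕ → Option Q) : Prop :=
  ∀ n, ∃ m, n ≤ m ∧ ∃ q, γ m = some q ∧ q ∈ A.acc

/-- There is an ω-branch of `Ĝ` starting at the vertex `v` of level `ℓ`. -/
def ldOmegaBranchFrom (A : NBW σ Q) [LinearOrder Q] (QN QD : Set Q)
    (dD : Q → σ → Q) (w : ℕ → σ) (v : Option Q) (ℓ : ℕ) : Prop :=
  ∃ γ : ℕ → Option Q, γ 0 = v ∧ (∀ i, ldVtx A QN QD dD w (γ i) (ℓ + i)) ∧
    ∀ i, ldEdge A QN QD dD w (γ i) (ℓ + i) (γ (i + 1))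

end NBW

namespace NBW

theorem ld_cnt_pos {Q : Type} [Fintype Q] [LinearOrder Q] (s : Set Q) (q : Q) (hq : q ∈ s) :
    1 ≤ {j ∈ s | j ≤ q}.ncard :=
  (Set.ncard_pos (Set.toFinite _)).2 ⟨q, hq, le_refl q⟩

theorem ld_cnt_le {Q : Type} [Fintype Q] [LinearOrder Q] (s : Set Q) (q : Q) :
    {j ∈ s | j ≤ q}.ncard ≤ s.ncard :=
  Set.ncard_le_ncard (fun _ h => h.1) (Set.toFinite _)

theorem ld_cnt_lt {Q : Type} [Fintype Q] [LinearOrder Q] (s : Set Q) (p q : Q)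
    (hq : q ∈ s) (h : p < q) : {j ∈ s | j ≤ p}.ncard < {j ∈ s | j ≤ q}.ncard := by
  apply Set.ncard_lt_ncard _ (Set.toFinite _)
  refine ⟨fun x hx => ⟨hx.1, hx.2.trans h.le⟩, fun hs => ?_⟩
  exact absurd (hs (show q ∈ {j ∈ s | j ≤ q} from ⟨hq, le_refl q⟩)).2 (not_le.2 h)

theorem ld_cnt_inj {Q : Type} [Fintype Q] [LinearOrder Q] (s : Set Q) (p q : Q)
    (hp : p ∈ s) (hq : q ∈ s) (h : {j ∈ s | j ≤ p}.ncard = {j ∈ s | j ≤ q}.ncard) :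
    p = q := by
  rcases lt_trichotomy p q with h1 | h1 | h1
  · have := ld_cnt_lt s p q hq h1
    omega
  · exact h1
  · have := ld_cnt_lt s q p hp h1
    omega

/-- Priorities are injective on the deterministic vertices of a level, and lie below the
priority of the nondeterministic vertex. -/
theorem ldPr_inv {σ Q : Type} [Fintype Q] [LinearOrder Q] (A : NBW σ Q) (QN QD : Set Q)
    (dD : Q → σ → Q) (w : ℕ → σ) (ℓ : ℕ) :
    (∀ q ∈ ldP A QN QD dD w ℓ, (ldPr A QN QD dD w ℓ).1 q < (ldPr A QN QD dD w ℓ).2) ∧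
    (∀ p ∈ ldP A QN QD dD w ℓ, ∀ q ∈ ldP A QN QD dD w ℓ,
      (ldPr A QN QD dD w ℓ).1 p = (ldPr A QN QD dD w ℓ).1 q → p = q) := by
  induction ℓ with
  | zero =>
    simp only [ldP, ldPr]
    exact ⟨fun q _ => Nat.lt_succ_of_le (ld_cnt_le _ q),
      fun p hp q hq h => ld_cnt_inj _ p q hp hq h⟩
  | succ ℓ ih =>
    obtain ⟨ih1, ih2⟩ := ih
    have hD : ∀ q ∈ ldD A QN QD dD w ℓ, ∃ q' ∈ ldP A QN QD dD w ℓ, dD q' (w ℓ) = q ∧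
        (ldPr A QN QD dD w (ℓ + 1)).1 q = (ldPr A QN QD dD w ℓ).1 q' := by
      intro q hq
      have hne : ((ldPr A QN QD dD w ℓ).1 ''
          {q' ∈ ldP A QN QD dD w ℓ | dD q' (w ℓ) = q}).Nonempty := by
        obtain ⟨x, hx, hxq⟩ := hq
        exact ⟨_, x, ⟨hx, hxq⟩, rfl⟩
      obtain ⟨x, ⟨hx, hxq⟩, hxe⟩ := Nat.sInf_mem hne
      refine ⟨x, hx, hxq, ?_⟩
      simp only [ldPr, if_pos hq]
      exact hxe.symm
    have hJ : ∀ q ∈ ldJ A QN QD dD w ℓ, (ldPr A QN QD dD w (ℓ + 1)).1 q =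
        (ldPr A QN QD dD w ℓ).2 + {j ∈ ldJ A QN QD dD w ℓ | j ≤ q}.ncard - 1 := by
      intro q hq
      simp only [ldPr, if_neg hq.2]
    have hP : ∀ q ∈ ldP A QN QD dD w (ℓ + 1),
        q ∈ ldD A QN QD dD w ℓ ∨ q ∈ ldJ A QN QD dD w ℓ := fun q hq => hq
    have h2 : (ldPr A QN QD dD w (ℓ + 1)).2 =
        (ldPr A QN QD dD w ℓ).2 + (ldJ A QN QD dD w ℓ).ncard := rfl
    constructor
    · intro q hq
      rcases hP q hq with h | h
      · obtain ⟨x, hx, -, hxe⟩ := hD q h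
        have := ih1 x hx
        omega
      · have := hJ q h
        have := ld_cnt_pos _ q h
        have := ld_cnt_le (ldJ A QN QD dD w ℓ) q
        omega
    · intro p hp q hq he
      rcases hP p hp with h | h <;> rcases hP q hq with h' | h'
      · obtain ⟨x, hx, hxp, hxe⟩ := hD p h
        obtain ⟨y, hy, hyq, hye⟩ := hD q h'
        have : x = y := ih2 x hx y hy (by omega)
        rw [← hxp, ← hyq, this]
      · obtain ⟨x, hx, -, hxe⟩ := hD p h
        have := ih1 x hx
        have := hJ q h'
        have := ld_cnt_pos _ q h'
        omega
      · obtain ⟨x, hx, -, hxe⟩ := hD q h'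
        have := ih1 x hx
        have := hJ p h
        have := ld_cnt_pos _ p h
        omega
      · have := hJ p h
        have := hJ q h'
        have := ld_cnt_pos _ p h
        have := ld_cnt_pos _ q h'
        exact ld_cnt_inj _ p q h h' (by omega)

end NBW

/-- The LDBW run DAG `Ĝ` is codeterministic: every vertex has at most one
incoming edge. -/
theorem NBW.ldbw_dag_codeterministic (σ Q : Type) [Fintype σ] [Nonempty σ] [Fintype Q]
    [LinearOrder Q] (A : NBW σ Q) (QN QD : Set Q) (dD : Q → σ → Q)
    (hc : A.Complete) (hld : A.LimitDetPart QN QD)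
    (hdD : ∀ q ∈ QD, ∀ a, A.trans q a = {dD q a})
    (hord : ∀ d ∈ QD, ∀ q ∈ QN, d ≤ q)
    (w : ℕ → σ) :
    ∀ (ℓ : ℕ) (v u u' : Option Q), A.ldVtx QN QD dD w v (ℓ + 1) →
      A.ldEdge QN QD dD w u ℓ v → A.ldEdge QN QD dD w u' ℓ v → u = u' := by
  intro ℓ v u u' _ h h'
  match v, u, u', h, h' with
  | none, none, none, _, _ => rfl
  | some _, none, none, _, _ => rfl
  | some d, none, some q, h, h' => exact absurd ⟨q, h'.1, h'.2.1.symm⟩ h.2.2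
  | some d, some q, none, h, h' => exact absurd ⟨q, h.1, h.2.1.symm⟩ h'.2.2
  | some d, some p, some q, h, h' =>
    exact congrArg some ((ldPr_inv A QN QD dD w ℓ).2 p h.1 q h'.1 (h.2.2.symm.trans h'.2.2))
end

section
/- Let A be a complete NBW over Σ that is limit deterministic with partition (Q_N, Q_D), fix a linear order ≼ on Q in which every element of Q_D precedes every element of Q_N, let w be an ω-word, and let Ĝ be the LDBW run DAG of A over w. Then w ∈ L(A) if and only if Ĝ has an accepting initial ω-branch. -/
open scoped Classical

namespace NBW

lemma ldP_succ {σ Q : Type} (A : NBW σ Q) (QN QD : Set Q) (dD : Q → σ → Q) (w : ℕ → σ) (l : ℕ) :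
    ldP A QN QD dD w (l + 1) = ldD A QN QD dD w l ∪ ldJ A QN QD dD w l := rfl

lemma ldP_sub {σ Q : Type} (A : NBW σ Q) (QN QD : Set Q) (dD : Q → σ → Q)
    (hdQ : ∀ q ∈ QD, ∀ a, dD q a ∈ QD) (w : ℕ → σ) (l : ℕ) :
    ldP A QN QD dD w l ⊆ QD := by
  induction l with
  | zero => exact fun q hq => hq.2
  | succ l ih =>
    rw [ldP_succ]
    rintro q (⟨q', hq', rfl⟩ | hq)
    · exact hdQ _ (ih hq') _
    · exact hq.1.2

lemma reach_glue {α : Type*} (init : α → Prop) (R : ℕ → α → α → Prop) (l : ℕ) (ρ : ℕ → α)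
    (τ : ℕ → α) (h0 : init (ρ 0)) (h1 : ∀ i < l, R i (ρ i) (ρ (i + 1))) (he : ρ l = τ l)
    (h2 : ∀ i, l ≤ i → R i (τ i) (τ (i + 1))) :
    ∃ μ : ℕ → α, init (μ 0) ∧ (∀ i, R i (μ i) (μ (i + 1))) ∧ (∀ i, l ≤ i → μ i = τ i) ∧
      ∀ i, i ≤ l → μ i = ρ i := by
  have hA : ∀ i, l ≤ i → (if i ≤ l then ρ i else τ i) = τ i := by
    intro i hi
    split_ifs with h
    · have : i = l := le_antisymm h hi
      subst this; exact he
    · rfl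
  refine ⟨fun i => if i ≤ l then ρ i else τ i, by simpa using h0, ?_, hA, ?_⟩
  · intro i
    rcases lt_or_ge i l with h | h
    · have h3 : i ≤ l := h.le
      have h4 : i + 1 ≤ l := h
      simp only [h3, h4, if_true]
      exact h1 i h
    · simp only [hA i h, hA (i + 1) (by omega)]
      exact h2 i h
  · intro i hi
    simp [hi]

lemma reach_succ {α : Type*} (init : α → Prop) (R : ℕ → α → α → Prop) (l : ℕ) (q q' : α)
    (h : ∃ ρ : ℕ → α, init (ρ 0) ∧ (∀ i < l, R i (ρ i) (ρ (i + 1))) ∧ ρ l = q)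
    (hq : R l q q') :
    ∃ ρ : ℕ → α, init (ρ 0) ∧ (∀ i < l + 1, R i (ρ i) (ρ (i + 1))) ∧ ρ (l + 1) = q' := by
  obtain ⟨ρ, h0, h1, rfl⟩ := h
  refine ⟨fun i => if i ≤ l then ρ i else q', by simpa using h0, ?_, by simp⟩
  intro i hi
  rcases lt_or_ge i l with h | h
  · have h3 : i ≤ l := h.le
    have h4 : i + 1 ≤ l := h
    simp only [h3, h4, if_true]
    exact h1 i h
  · have : i = l := by omega
    subst this
    simpa using hq

lemma reach_S {σ Q : Type} (A : NBW σ Q) (QN : Set Q) (w : ℕ → σ) (l : ℕ) :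
    ∀ q ∈ ldS A QN w l, ∃ ρ : ℕ → Q, ρ 0 ∈ A.init ∧
      (∀ i < l, ρ (i + 1) ∈ A.trans (ρ i) (w i)) ∧ ρ l = q := by
  induction l with
  | zero => exact fun q hq => ⟨fun _ => q, hq.1, by simp, rfl⟩
  | succ l ih =>
    rintro q ⟨hq, -⟩
    simp only [Set.mem_iUnion] at hq
    obtain ⟨q', hq', hqq⟩ := hq
    exact reach_succ (· ∈ A.init) (fun i a b => b ∈ A.trans a (w i)) l q' q (ih q' hq') hqq

lemma reach_P {σ Q : Type} (A : NBW σ Q) (QN QD : Set Q) (dD : Q → σ → Q)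
    (hdD : ∀ q ∈ QD, ∀ a, A.trans q a = {dD q a})
    (hdQ : ∀ q ∈ QD, ∀ a, dD q a ∈ QD) (w : ℕ → σ) (l : ℕ) :
    ∀ q ∈ ldP A QN QD dD w l, ∃ ρ : ℕ → Q, ρ 0 ∈ A.init ∧
      (∀ i < l, ρ (i + 1) ∈ A.trans (ρ i) (w i)) ∧ ρ l = q := by
  induction l with
  | zero => exact fun q hq => ⟨fun _ => q, hq.1, by simp, rfl⟩
  | succ l ih =>
    rw [ldP_succ]
    rintro q (⟨q', hq', rfl⟩ | ⟨⟨hq, -⟩, -⟩)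
    · refine reach_succ (· ∈ A.init) (fun i a b => b ∈ A.trans a (w i)) l q' _ (ih q' hq') ?_
      simp [hdD q' (ldP_sub A QN QD dD hdQ w l hq')]
    · simp only [Set.mem_iUnion] at hq
      obtain ⟨q', hq', hqq⟩ := hq
      exact reach_succ (· ∈ A.init) (fun i a b => b ∈ A.trans a (w i)) l q' q
        (reach_S A QN w l q' hq') hqq

lemma reach_V {σ Q : Type} [LinearOrder Q] (A : NBW σ Q) (QN QD : Set Q) (dD : Q → σ → Q)
    (w : ℕ → σ) (l : ℕ) :
    ∀ v, ldVtx A QN QD dD w v l → ∃ γ : ℕ → Option Q, ldVtx A QN QD dD w (γ 0) 0 ∧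
      (∀ i < l, ldVtx A QN QD dD w (γ (i + 1)) (i + 1) ∧
        ldEdge A QN QD dD w (γ i) i (γ (i + 1))) ∧ γ l = v := by
  induction l with
  | zero => exact fun v hv => ⟨fun _ => v, hv, by simp, rfl⟩
  | succ l ih =>
    intro v hv
    suffices h : ∃ u, ldVtx A QN QD dD w u l ∧ ldEdge A QN QD dD w u l v by
      obtain ⟨u, hu, he⟩ := h
      exact reach_succ (fun u => ldVtx A QN QD dD w u 0)
        (fun i a b => ldVtx A QN QD dD w b (i + 1) ∧ ldEdge A QN QD dD w a i b) l u v
        (ih u hu) ⟨hv, he⟩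
    cases v with
    | none =>
      have hv' := hv
      obtain ⟨q, hq, -⟩ := hv'
      simp only [Set.mem_iUnion] at hq
      obtain ⟨q', hq', -⟩ := hq
      exact ⟨none, ⟨q', hq'⟩, ⟨q', hq'⟩, hv⟩
    | some q =>
      rcases (hv : q ∈ ldD A QN QD dD w l ∪ ldJ A QN QD dD w l) with hD | hJ
      · have hne : ((ldPr A QN QD dD w l).1 ''
            {q' ∈ ldP A QN QD dD w l | dD q' (w l) = q}).Nonempty := by
          obtain ⟨q', h1, h2⟩ := hD
          exact ⟨_, q', ⟨h1, h2⟩, rfl⟩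
        obtain ⟨q', ⟨h1, h2⟩, h3⟩ := Nat.sInf_mem hne
        refine ⟨some q', h1, h1, h2.symm, ?_⟩
        rw [h3, ldPr]
        exact if_pos hD
      · have hJ' := hJ
        obtain ⟨⟨hq, -⟩, -⟩ := hJ'
        simp only [Set.mem_iUnion] at hq
        obtain ⟨q', hq', -⟩ := hq
        exact ⟨none, ⟨q', hq'⟩, ⟨q', hq'⟩, hJ⟩

lemma run_mem {σ Q : Type} (A : NBW σ Q) (QN QD : Set Q) (dD : Q → σ → Q)
    (hu : QN ∪ QD = Set.univ) (hdD : ∀ q ∈ QD, ∀ a, A.trans q a = {dD q a})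
    (hdQ : ∀ q ∈ QD, ∀ a, dD q a ∈ QD)
    (w : ℕ → σ) (ρ : ℕ → Q) (hρ : A.IsRun w ρ) (l : ℕ) :
    ρ l ∈ ldS A QN w l ∨ ρ l ∈ ldP A QN QD dD w l := by
  induction l with
  | zero =>
    rcases (hu ▸ Set.mem_univ (ρ 0) : ρ 0 ∈ QN ∪ QD) with h | h
    · exact Or.inl ⟨hρ.1, h⟩
    · exact Or.inr ⟨hρ.1, h⟩
  | succ l ih =>
    have hs := hρ.2 l
    rcases ih with h | h
    · have hU : ρ (l + 1) ∈ ⋃ q ∈ ldS A QN w l, A.trans q (w l) := by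
        simp only [Set.mem_iUnion]
        exact ⟨_, h, hs⟩
      rcases (hu ▸ Set.mem_univ (ρ (l + 1)) : ρ (l + 1) ∈ QN ∪ QD) with h' | h'
      · exact Or.inl ⟨hU, h'⟩
      · right
        by_cases hD : ρ (l + 1) ∈ ldD A QN QD dD w l
        · exact Or.inl hD
        · exact Or.inr ⟨⟨hU, h'⟩, hD⟩
    · rw [hdD _ (ldP_sub A QN QD dD hdQ w l h)] at hs
      exact Or.inr (Or.inl ⟨_, h, hs.symm⟩)

end NBW

/-- `w ∈ L(A)` iff the LDBW run DAG `Ĝ` of `A` over `w` has an accepting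
initial ω-branch. -/
theorem NBW.ldbw_dag_acceptance (σ Q : Type) [Fintype σ] [Nonempty σ] [Fintype Q]
    [LinearOrder Q] (A : NBW σ Q) (QN QD : Set Q) (dD : Q → σ → Q)
    (hc : A.Complete) (hld : A.LimitDetPart QN QD)
    (hdD : ∀ q ∈ QD, ∀ a, A.trans q a = {dD q a})
    (hord : ∀ d ∈ QD, ∀ q ∈ QN, d ≤ q)
    (w : ℕ → σ) :
    w ∈ A.Lang ↔
      ∃ γ : ℕ → Option Q, A.ldInitOmegaBranch QN QD dD w γ ∧
        A.ldAcceptingBranch γ := by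
  obtain ⟨hdisj, hu, hF, hdet⟩ := hld
  have hdQ : ∀ q ∈ QD, ∀ a, dD q a ∈ QD := by
    intro q hq a
    obtain ⟨q', h1, h2⟩ := hdet q hq a
    rw [hdD q hq a] at h2
    rw [Set.singleton_injective h2]
    exact h1
  constructor
  · rintro ⟨ρ, hρ, hacc⟩
    obtain ⟨m, -, hm⟩ := hacc 0
    have hP : ∀ k, ρ (m + k) ∈ ldP A QN QD dD w (m + k) := by
      intro k
      induction k with
      | zero =>
        rcases run_mem A QN QD dD hu hdD hdQ w ρ hρ m with h | h
        · exfalso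
          have : ρ m ∈ QN := by
            cases m with
            | zero => exact h.2
            | succ m => exact h.2
          exact Set.disjoint_left.1 hdisj this (hF hm)
        · exact h
      | succ k ih =>
        have hs := hρ.2 (m + k)
        rw [hdD _ (ldP_sub A QN QD dD hdQ w _ ih)] at hs
        exact Or.inl ⟨_, ih, hs.symm⟩
    have hstep : ∀ k, ρ (m + k + 1) = dD (ρ (m + k)) (w (m + k)) := by
      intro k
      have hs := hρ.2 (m + k)
      rw [hdD _ (ldP_sub A QN QD dD hdQ w _ (hP k))] at hs
      exact hs
    let p : ℕ → ℕ := fun k => (ldPr A QN QD dD w (m + k)).1 (ρ (m + k))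
    have hanti : Antitone p := by
      apply antitone_nat_of_succ_le
      intro k
      have hD : ρ (m + k + 1) ∈ ldD A QN QD dD w (m + k) := ⟨_, hP k, (hstep k).symm⟩
      change (ldPr A QN QD dD w (m + k + 1)).1 (ρ (m + k + 1)) ≤ _
      rw [ldPr]
      simp only [hD, if_true]
      exact Nat.sInf_le ⟨_, ⟨hP k, (hstep k).symm⟩, rfl⟩
    obtain ⟨n, hn⟩ := Nat.sInf_mem (Set.range_nonempty p)
    have hconst : ∀ k, n ≤ k → p k = p n := fun k hk =>
      le_antisymm (hanti hk) (hn ▸ Nat.sInf_le ⟨k, rfl⟩)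
    obtain ⟨γ, h0, h1, h2⟩ := reach_V A QN QD dD w (m + n) (some (ρ (m + n))) (hP n)
    obtain ⟨μ, hμ0, hμ1, hμ2, -⟩ := reach_glue (fun u => ldVtx A QN QD dD w u 0)
        (fun i a b => ldVtx A QN QD dD w b (i + 1) ∧ ldEdge A QN QD dD w a i b) (m + n) γ
        (fun i => some (ρ i)) h0 h1 h2 (by
          intro i hi
          obtain ⟨k, rfl⟩ := Nat.exists_eq_add_of_le (le_trans (Nat.le_add_right m n) hi)
          refine ⟨hP (k + 1), hP k, hstep k, ?_⟩
          exact (hconst (k + 1) (by omega)).trans (hconst k (by omega)).symm)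
    refine ⟨μ, ⟨?_, fun l => (hμ1 l).2⟩, ?_⟩
    · intro l
      cases l with
      | zero => exact hμ0
      | succ l => exact (hμ1 l).1
    · intro N
      obtain ⟨i, hi, hiF⟩ := hacc (max N (m + n))
      exact ⟨i, le_trans (le_max_left _ _) hi, ρ i, hμ2 i (le_trans (le_max_right _ _) hi), hiF⟩
  · rintro ⟨γ, ⟨hV, hE⟩, hacc⟩
    obtain ⟨m, -, q, hq, hqF⟩ := hacc 0
    have hsome : ∀ i, m ≤ i → ∃ q, γ i = some q := by
      intro i hi
      induction i, hi using Nat.le_induction with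
      | base => exact ⟨q, hq⟩
      | succ i hi ih =>
        obtain ⟨r, hr⟩ := ih
        have := hE i
        rw [hr] at this
        cases hc' : γ (i + 1) with
        | none => rw [hc'] at this; exact this.elim
        | some d => exact ⟨d, rfl⟩
    let τ : ℕ → Q := fun i => (γ i).getD q
    have hτ : ∀ i, m ≤ i → γ i = some (τ i) := by
      intro i hi
      obtain ⟨r, hr⟩ := hsome i hi
      simp [τ, hr]
    have hPm := hV m
    rw [hq] at hPm
    obtain ⟨ρ, h0, h1, h2⟩ := reach_P A QN QD dD hdD hdQ w m q hPm
    obtain ⟨μ, hμ0, hμ1, hμ2, -⟩ := reach_glue (· ∈ A.init)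
        (fun i a b => b ∈ A.trans a (w i)) m ρ τ h0 h1 (by simp [τ, hq, h2]) (by
          intro i hi
          have he := hE i
          rw [hτ i hi, hτ (i + 1) (by omega)] at he
          obtain ⟨e1, e2, -⟩ := he
          rw [hdD _ (ldP_sub A QN QD dD hdQ w _ e1)]
          exact e2)
    refine ⟨μ, ⟨hμ0, hμ1⟩, ?_⟩
    intro N
    obtain ⟨i, hi, r, hr, hrF⟩ := hacc (max N m)
    have him : m ≤ i := le_trans (le_max_right _ _) hi
    refine ⟨i, le_trans (le_max_left _ _) hi, ?_⟩
    rw [hμ2 i him]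
    simpa [τ, hr] using hrF
end

section
/- Let A be a complete NBW over Σ that is limit deterministic with partition (Q_N, Q_D), fix a linear order ≼ on Q in which every element of Q_D precedes every element of Q_N, let w be an ω-word, and let Ĝ be the LDBW run DAG of A over w. Then Ĝ has at most |Q| distinct ω-branches starting at level 0. -/
open scoped Classical

theorem NBW.rank_inj {Q : Type} [Fintype Q] [LinearOrder Q] (J : Set Q) {a b : Q}
    (ha : a ∈ J) (hb : b ∈ J)
    (h : {j ∈ J | j ≤ a}.ncard = {j ∈ J | j ≤ b}.ncard) : a = b := by
  have key : ∀ x y : Q, y ∈ J → x < y → {j ∈ J | j ≤ x}.ncard < {j ∈ J | j ≤ y}.ncard := by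
    intro x y hy hxy
    apply Set.ncard_lt_ncard _ (Set.toFinite _)
    refine ⟨fun j hj => ⟨hj.1, hj.2.trans hxy.le⟩, fun hsub => ?_⟩
    have := (hsub (show y ∈ {j ∈ J | j ≤ y} from ⟨hy, le_rfl⟩)).2
    exact absurd this (not_le.mpr hxy)
  rcases lt_trichotomy a b with hab | hab | hab
  · have := key a b hb hab
    omega
  · exact hab
  · have := key b a ha hab
    omega

theorem NBW.rank_pos {Q : Type} [Fintype Q] [LinearOrder Q] (J : Set Q) {a : Q}
    (ha : a ∈ J) : 0 < {j ∈ J | j ≤ a}.ncard :=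
  (Set.ncard_pos (Set.toFinite _)).mpr ⟨a, ha, le_rfl⟩

theorem NBW.rank_le {Q : Type} [Fintype Q] [LinearOrder Q] (J : Set Q) (a : Q) :
    {j ∈ J | j ≤ a}.ncard ≤ J.ncard :=
  Set.ncard_le_ncard (fun _ hj => hj.1) (Set.toFinite _)

theorem NBW.ldP_succ_s17 {σ Q : Type} (A : NBW σ Q) (QN QD : Set Q) (dD : Q → σ → Q)
    (w : ℕ → σ) (n : ℕ) :
    A.ldP QN QD dD w (n + 1) = A.ldD QN QD dD w n ∪ A.ldJ QN QD dD w n := rfl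

theorem NBW.ldPr_D {σ Q : Type} [LinearOrder Q] (A : NBW σ Q) (QN QD : Set Q)
    (dD : Q → σ → Q) (w : ℕ → σ) (n : ℕ) {d : Q} (hd : d ∈ A.ldD QN QD dD w n) :
    ∃ q ∈ A.ldP QN QD dD w n, dD q (w n) = d ∧
      (A.ldPr QN QD dD w (n + 1)).1 d = (A.ldPr QN QD dD w n).1 q := by
  have hne : ((A.ldPr QN QD dD w n).1 ''
      {q' ∈ A.ldP QN QD dD w n | dD q' (w n) = d}).Nonempty := by
    obtain ⟨q, hq, hqd⟩ := hd
    exact ⟨_, q, ⟨hq, hqd⟩, rfl⟩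
  obtain ⟨q, ⟨hq, hqd⟩, he⟩ := Nat.sInf_mem hne
  refine ⟨q, hq, hqd, ?_⟩
  rw [he]
  simp only [NBW.ldPr, if_pos hd]

theorem NBW.ldPr_J {σ Q : Type} [LinearOrder Q] (A : NBW σ Q) (QN QD : Set Q)
    (dD : Q → σ → Q) (w : ℕ → σ) (n : ℕ) {d : Q} (hd : d ∈ A.ldJ QN QD dD w n) :
    (A.ldPr QN QD dD w (n + 1)).1 d =
      (A.ldPr QN QD dD w n).2 + {j ∈ A.ldJ QN QD dD w n | j ≤ d}.ncard - 1 := by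
  have : d ∉ A.ldD QN QD dD w n := hd.2
  simp only [NBW.ldPr, if_neg this]

/-- Priorities are injective on the deterministic vertices of a level, and all smaller than the
priority of the nondeterministic vertex. -/
theorem NBW.ldPr_inv_s17 {σ Q : Type} [Fintype Q] [LinearOrder Q] (A : NBW σ Q) (QN QD : Set Q)
    (dD : Q → σ → Q) (w : ℕ → σ) (n : ℕ) :
    Set.InjOn (A.ldPr QN QD dD w n).1 (A.ldP QN QD dD w n) ∧
      ∀ q ∈ A.ldP QN QD dD w n, (A.ldPr QN QD dD w n).1 q < (A.ldPr QN QD dD w n).2 := by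
  induction n with
  | zero =>
    refine ⟨fun a ha b hb h => NBW.rank_inj (A.init ∩ QD) ha hb h, fun q hq => ?_⟩
    exact Nat.lt_succ_of_le (NBW.rank_le (A.init ∩ QD) q)
  | succ n ih =>
    obtain ⟨hinj, hlt⟩ := ih
    have h2 : (A.ldPr QN QD dD w (n + 1)).2 =
      (A.ldPr QN QD dD w n).2 + (A.ldJ QN QD dD w n).ncard := rfl
    have hD : ∀ d ∈ A.ldD QN QD dD w n,
        (A.ldPr QN QD dD w (n + 1)).1 d < (A.ldPr QN QD dD w n).2 := by
      intro d hd
      obtain ⟨q, hq, -, he⟩ := NBW.ldPr_D A QN QD dD w n hd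
      rw [he]
      exact hlt q hq
    have hJ : ∀ d ∈ A.ldJ QN QD dD w n,
        (A.ldPr QN QD dD w n).2 ≤ (A.ldPr QN QD dD w (n + 1)).1 d := by
      intro d hd
      have := NBW.rank_pos _ hd
      rw [NBW.ldPr_J A QN QD dD w n hd]
      omega
    rw [NBW.ldP_succ_s17]
    constructor
    · rintro a (ha | ha) b (hb | hb) h
      · obtain ⟨q, hq, hqa, he⟩ := NBW.ldPr_D A QN QD dD w n ha
        obtain ⟨q', hq', hqb, he'⟩ := NBW.ldPr_D A QN QD dD w n hb
        have : q = q' := hinj hq hq' (by rw [← he, ← he', h])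
        rw [← hqa, ← hqb, this]
      · have := hD a ha
        have := hJ b hb
        omega
      · have := hD b hb
        have := hJ a ha
        omega
      · have pa := NBW.rank_pos _ ha
        have pb := NBW.rank_pos _ hb
        rw [NBW.ldPr_J A QN QD dD w n ha, NBW.ldPr_J A QN QD dD w n hb] at h
        exact NBW.rank_inj _ ha hb (by omega)
    · rintro q (hq | hq)
      · have := hD q hq
        omega
      · have pa := NBW.rank_pos _ hq
        have := NBW.rank_le (A.ldJ QN QD dD w n) q
        rw [NBW.ldPr_J A QN QD dD w n hq]
        omega

/-- Every vertex has at most one predecessor. -/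
theorem NBW.ldEdge_pred_unique {σ Q : Type} [Fintype Q] [LinearOrder Q] (A : NBW σ Q)
    (QN QD : Set Q) (dD : Q → σ → Q) (w : ℕ → σ) (n : ℕ) (u u' v : Option Q)
    (h : A.ldEdge QN QD dD w u n v) (h' : A.ldEdge QN QD dD w u' n v) : u = u' := by
  rcases v with _ | d <;> rcases u with _ | q <;> rcases u' with _ | q' <;>
    simp only [NBW.ldEdge] at h h'
  · rfl
  · rfl
  · exact absurd ⟨q', h'.1, h'.2.1.symm⟩ h.2.2
  · exact absurd ⟨q, h.1, h.2.1.symm⟩ h'.2.2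
  · have : q = q' := (NBW.ldPr_inv_s17 A QN QD dD w n).1 h.1 h'.1 (by rw [← h.2.2, ← h'.2.2])
    rw [this]

theorem NBW.ldP_subset {σ Q : Type} (A : NBW σ Q)
    (QN QD : Set Q) (dD : Q → σ → Q) (hld : A.LimitDetPart QN QD)
    (hdD : ∀ q ∈ QD, ∀ a, A.trans q a = {dD q a}) (w : ℕ → σ) (n : ℕ) :
    A.ldP QN QD dD w n ⊆ QD := by
  induction n with
  | zero => exact fun q hq => hq.2
  | succ n ih =>
    rw [NBW.ldP_succ_s17]
    rintro _ (⟨q, hq, rfl⟩ | hq)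
    · obtain ⟨q', hq', he⟩ := hld.2.2.2 q (ih hq) (w n)
      rw [hdD q (ih hq)] at he
      have : dD q (w n) = q' := Set.singleton_injective he
      show dD q (w n) ∈ QD
      rw [this]
      exact hq'
    · exact hq.1.2

theorem NBW.ldS_subset {σ Q : Type} (A : NBW σ Q) (QN : Set Q) (w : ℕ → σ) (n : ℕ) :
    A.ldS QN w n ⊆ QN := by
  cases n with
  | zero => exact fun q hq => hq.2
  | succ n => exact fun q hq => hq.2

theorem NBW.branch_finset_bound {σ Q : Type} [Fintype Q] [LinearOrder Q] (A : NBW σ Q)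
    (QN QD : Set Q) (dD : Q → σ → Q) (hld : A.LimitDetPart QN QD)
    (hdD : ∀ q ∈ QD, ∀ a, A.trans q a = {dD q a}) (w : ℕ → σ)
    (T : Finset (ℕ → Option Q)) (hT : ∀ γ ∈ T, A.ldInitOmegaBranch QN QD dD w γ) :
    T.card ≤ Fintype.card Q := by
  have hpair : ∀ γ ∈ T, ∀ γ' ∈ T, ∀ᶠ n in Filter.atTop, γ n = γ' n → γ = γ' := by
    intro γ hγ γ' hγ'
    by_cases hne : γ = γ'
    · exact Filter.Eventually.of_forall fun _ _ => hne
    · obtain ⟨k, hk⟩ := Function.ne_iff.mp hne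
      filter_upwards [Filter.eventually_ge_atTop k] with n hn he
      exfalso
      induction n, hn using Nat.le_induction with
      | base => exact hk he
      | succ n hn ih =>
        apply ih
        have h1 := (hT γ hγ).2 n
        have h2 := (hT γ' hγ').2 n
        rw [← he] at h2
        exact NBW.ldEdge_pred_unique A QN QD dD w n _ _ _ h1 h2
  have hall : ∀ᶠ n in Filter.atTop, ∀ γ ∈ T, ∀ γ' ∈ T, γ n = γ' n → γ = γ' := by
    rw [Filter.eventually_all_finset]
    intro γ hγ
    rw [Filter.eventually_all_finset]
    exact hpair γ hγ
  obtain ⟨n, hn⟩ := hall.exists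
  by_cases hS : (A.ldS QN w n).Nonempty
  · obtain ⟨s, hs⟩ := hS
    have hsN : s ∉ QD := fun h => Set.disjoint_left.mp hld.1 (NBW.ldS_subset A QN w n hs) h
    refine Finset.card_le_card_of_injOn (t := Finset.univ) (fun γ => (γ n).getD s)
      (fun _ _ => Finset.mem_coe.mpr (Finset.mem_univ _)) ?_
    intro γ hγ γ' hγ' he
    apply hn γ hγ γ' hγ'
    have v1 := (hT γ hγ).1 n
    have v2 := (hT γ' hγ').1 n
    simp only at he
    rcases h1 : γ n with _ | q <;> rcases h2 : γ' n with _ | q' <;>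
      rw [h1, h2] at he <;> rw [h1] at v1 <;> rw [h2] at v2 <;>
      simp only [Option.getD, NBW.ldVtx] at he v1 v2
    · exact absurd (he ▸ NBW.ldP_subset A QN QD dD hld hdD w n v2) hsN
    · exact absurd (he ▸ NBW.ldP_subset A QN QD dD hld hdD w n v1) hsN
    · rw [he]
  · have hsome : ∀ γ ∈ T, γ n ≠ none := by
      intro γ hγ h
      have v1 := (hT γ hγ).1 n
      rw [h] at v1
      exact hS v1
    rcases T.eq_empty_or_nonempty with rfl | ⟨γ₀, h₀⟩
    · simp
    obtain ⟨s, -⟩ := Option.ne_none_iff_exists'.mp (hsome γ₀ h₀)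
    refine Finset.card_le_card_of_injOn (t := Finset.univ) (fun γ => (γ n).getD s)
      (fun _ _ => Finset.mem_coe.mpr (Finset.mem_univ _)) ?_
    intro γ hγ γ' hγ' he
    apply hn γ hγ γ' hγ'
    obtain ⟨q, hq⟩ := Option.ne_none_iff_exists'.mp (hsome γ hγ)
    obtain ⟨q', hq'⟩ := Option.ne_none_iff_exists'.mp (hsome γ' hγ')
    simp only [hq, hq', Option.getD] at he
    rw [hq, hq', he]

/-- The LDBW run DAG `Ĝ` has at most `|Q|` distinct ω-branches starting at
level `0`. -/
theorem NBW.ldbw_dag_branch_bound (σ Q : Type) [Fintype σ] [Nonempty σ] [Fintype Q]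
    [LinearOrder Q] (A : NBW σ Q) (QN QD : Set Q) (dD : Q → σ → Q)
    (hc : A.Complete) (hld : A.LimitDetPart QN QD)
    (hdD : ∀ q ∈ QD, ∀ a, A.trans q a = {dD q a})
    (hord : ∀ d ∈ QD, ∀ q ∈ QN, d ≤ q)
    (w : ℕ → σ) :
    {γ : ℕ → Option Q | A.ldInitOmegaBranch QN QD dD w γ}.Finite ∧
    {γ : ℕ → Option Q | A.ldInitOmegaBranch QN QD dD w γ}.ncard ≤
      Fintype.card Q := by
  have hb := fun T hT => NBW.branch_finset_bound A QN QD dD hld hdD w T hT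
  have hfin : {γ : ℕ → Option Q | A.ldInitOmegaBranch QN QD dD w γ}.Finite := by
    by_contra hinf
    obtain ⟨T, hT, hcard⟩ :=
      Set.Infinite.exists_subset_card_eq hinf (Fintype.card Q + 1)
    have := hb T (fun γ hγ => hT hγ)
    omega
  refine ⟨hfin, ?_⟩
  rw [Set.ncard_eq_toFinset_card _ hfin]
  exact hb _ (fun γ hγ => by simpa using hγ)
end
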